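/- arXiv:2003.03195 — 3 statements merged into one kernel-verified Lean document; each statement's English description precedes it below -/
import Mathlib

section
/- 2D biorthogonality (Section 11): There exists δ > 0 such that for every Φ ∈ ℝ⁴ with |Φ| < 2δ and φ₂ ≠ 0: (λ₁² − b)(λ₂² − b) + c² = 0, the quantities K and N are nonzero, and l^i · r_j = δ^i_j (Kronecker delta) for all i, j ∈ {1,2,3,4}. -/
set_option linter.unusedVariables false

noncomputable section

open Real Matrix

/-- `a = c₁² + 2σ₀φ₁`. -/
def aa4 (c₁ σ₀ : ℝ) (Φ : Fin 4 → ℝ) : ℝ := c₁ ^ 2 + 2 * σ₀ * Φ 0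
/-- `b = c₂² + 2σ₁φ₁`. -/
def bb4 (c₂ σ₁ : ℝ) (Φ : Fin 4 → ℝ) : ℝ := c₂ ^ 2 + 2 * σ₁ * Φ 0
/-- `c = 2σ₁φ₂`. -/
def cc4 (σ₁ : ℝ) (Φ : Fin 4 → ℝ) : ℝ := 2 * σ₁ * Φ 1

/-- The coefficient matrix `A(Φ)` of the 4×4 first-order system (2D elastic plane waves). -/
def Amat4 (c₁ c₂ σ₀ σ₁ : ℝ) (Φ : Fin 4 → ℝ) : Matrix (Fin 4) (Fin 4) ℝ :=
  Matrix.of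
    ![![0, 0, -1, 0],
      ![0, 0, 0, -1],
      ![-aa4 c₁ σ₀ Φ, -cc4 σ₁ Φ, 0, 0],
      ![-cc4 σ₁ Φ, -bb4 c₂ σ₁ Φ, 0, 0]]

/-- `Δ = (a−b)² + 4c²`. -/
def Del4 (c₁ c₂ σ₀ σ₁ : ℝ) (Φ : Fin 4 → ℝ) : ℝ :=
  (aa4 c₁ σ₀ Φ - bb4 c₂ σ₁ Φ) ^ 2 + 4 * (cc4 σ₁ Φ) ^ 2

/-- `λ₁ = ((a+b)/2 + √Δ/2)^{1/2}`. -/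
def mu1 (c₁ c₂ σ₀ σ₁ : ℝ) (Φ : Fin 4 → ℝ) : ℝ :=
  Real.sqrt ((aa4 c₁ σ₀ Φ + bb4 c₂ σ₁ Φ) / 2 + Real.sqrt (Del4 c₁ c₂ σ₀ σ₁ Φ) / 2)
/-- `λ₂ = ((a+b)/2 − √Δ/2)^{1/2}`. -/
def mu2 (c₁ c₂ σ₀ σ₁ : ℝ) (Φ : Fin 4 → ℝ) : ℝ :=
  Real.sqrt ((aa4 c₁ σ₀ Φ + bb4 c₂ σ₁ Φ) / 2 - Real.sqrt (Del4 c₁ c₂ σ₀ σ₁ Φ) / 2)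
/-- `λ₃ = −λ₂`. -/
def mu3 (c₁ c₂ σ₀ σ₁ : ℝ) (Φ : Fin 4 → ℝ) : ℝ := -mu2 c₁ c₂ σ₀ σ₁ Φ
/-- `λ₄ = −λ₁`. -/
def mu4 (c₁ c₂ σ₀ σ₁ : ℝ) (Φ : Fin 4 → ℝ) : ℝ := -mu1 c₁ c₂ σ₀ σ₁ Φ

/-- Right eigenvector `r₁`. -/
def s1 (c₁ c₂ σ₀ σ₁ : ℝ) (Φ : Fin 4 → ℝ) : Fin 4 → ℝ :=
  ![((mu1 c₁ c₂ σ₀ σ₁ Φ) ^ 2 - bb4 c₂ σ₁ Φ) / (2 * σ₁), Φ 1,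
    -(mu1 c₁ c₂ σ₀ σ₁ Φ * ((mu1 c₁ c₂ σ₀ σ₁ Φ) ^ 2 - bb4 c₂ σ₁ Φ)) / (2 * σ₁),
    -(mu1 c₁ c₂ σ₀ σ₁ Φ) * Φ 1]

/-- Right eigenvector `r₂`. -/
def s2 (c₁ c₂ σ₀ σ₁ : ℝ) (Φ : Fin 4 → ℝ) : Fin 4 → ℝ :=
  ![((mu2 c₁ c₂ σ₀ σ₁ Φ) ^ 2 - bb4 c₂ σ₁ Φ) / (2 * σ₁), Φ 1,
    -(mu2 c₁ c₂ σ₀ σ₁ Φ * ((mu2 c₁ c₂ σ₀ σ₁ Φ) ^ 2 - bb4 c₂ σ₁ Φ)) / (2 * σ₁),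
    -(mu2 c₁ c₂ σ₀ σ₁ Φ) * Φ 1]

/-- Right eigenvector `r₃`. -/
def s3 (c₁ c₂ σ₀ σ₁ : ℝ) (Φ : Fin 4 → ℝ) : Fin 4 → ℝ :=
  ![((mu2 c₁ c₂ σ₀ σ₁ Φ) ^ 2 - bb4 c₂ σ₁ Φ) / (2 * σ₁), Φ 1,
    mu2 c₁ c₂ σ₀ σ₁ Φ * ((mu2 c₁ c₂ σ₀ σ₁ Φ) ^ 2 - bb4 c₂ σ₁ Φ) / (2 * σ₁),
    mu2 c₁ c₂ σ₀ σ₁ Φ * Φ 1]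

/-- Right eigenvector `r₄`. -/
def s4 (c₁ c₂ σ₀ σ₁ : ℝ) (Φ : Fin 4 → ℝ) : Fin 4 → ℝ :=
  ![((mu1 c₁ c₂ σ₀ σ₁ Φ) ^ 2 - bb4 c₂ σ₁ Φ) / (2 * σ₁), Φ 1,
    mu1 c₁ c₂ σ₀ σ₁ Φ * ((mu1 c₁ c₂ σ₀ σ₁ Φ) ^ 2 - bb4 c₂ σ₁ Φ) / (2 * σ₁),
    mu1 c₁ c₂ σ₀ σ₁ Φ * Φ 1]

/-- `K = (Δ + (a−b)√Δ)/(4σ₁²)`. -/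
def Kc4 (c₁ c₂ σ₀ σ₁ : ℝ) (Φ : Fin 4 → ℝ) : ℝ :=
  (Del4 c₁ c₂ σ₀ σ₁ Φ + (aa4 c₁ σ₀ Φ - bb4 c₂ σ₁ Φ) * Real.sqrt (Del4 c₁ c₂ σ₀ σ₁ Φ)) /
    (4 * σ₁ ^ 2)

/-- `N = (Δ − (a−b)√Δ)/(4σ₁²)`. -/
def Nc4 (c₁ c₂ σ₀ σ₁ : ℝ) (Φ : Fin 4 → ℝ) : ℝ :=
  (Del4 c₁ c₂ σ₀ σ₁ Φ - (aa4 c₁ σ₀ Φ - bb4 c₂ σ₁ Φ) * Real.sqrt (Del4 c₁ c₂ σ₀ σ₁ Φ)) /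
    (4 * σ₁ ^ 2)

/-- Left eigenvector `l¹`. -/
def t1 (c₁ c₂ σ₀ σ₁ : ℝ) (Φ : Fin 4 → ℝ) : Fin 4 → ℝ :=
  (1 / Kc4 c₁ c₂ σ₀ σ₁ Φ) •
    ![((mu1 c₁ c₂ σ₀ σ₁ Φ) ^ 2 - bb4 c₂ σ₁ Φ) / (2 * σ₁), Φ 1,
      -(((mu1 c₁ c₂ σ₀ σ₁ Φ) ^ 2 - bb4 c₂ σ₁ Φ) / (2 * σ₁ * mu1 c₁ c₂ σ₀ σ₁ Φ)),
      -(Φ 1 / mu1 c₁ c₂ σ₀ σ₁ Φ)]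

/-- Left eigenvector `l²`. -/
def t2 (c₁ c₂ σ₀ σ₁ : ℝ) (Φ : Fin 4 → ℝ) : Fin 4 → ℝ :=
  (1 / Nc4 c₁ c₂ σ₀ σ₁ Φ) •
    ![((mu2 c₁ c₂ σ₀ σ₁ Φ) ^ 2 - bb4 c₂ σ₁ Φ) / (2 * σ₁), Φ 1,
      -(((mu2 c₁ c₂ σ₀ σ₁ Φ) ^ 2 - bb4 c₂ σ₁ Φ) / (2 * σ₁ * mu2 c₁ c₂ σ₀ σ₁ Φ)),
      -(Φ 1 / mu2 c₁ c₂ σ₀ σ₁ Φ)]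

/-- Left eigenvector `l³`. -/
def t3 (c₁ c₂ σ₀ σ₁ : ℝ) (Φ : Fin 4 → ℝ) : Fin 4 → ℝ :=
  (1 / Nc4 c₁ c₂ σ₀ σ₁ Φ) •
    ![((mu2 c₁ c₂ σ₀ σ₁ Φ) ^ 2 - bb4 c₂ σ₁ Φ) / (2 * σ₁), Φ 1,
      ((mu2 c₁ c₂ σ₀ σ₁ Φ) ^ 2 - bb4 c₂ σ₁ Φ) / (2 * σ₁ * mu2 c₁ c₂ σ₀ σ₁ Φ),
      Φ 1 / mu2 c₁ c₂ σ₀ σ₁ Φ]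

/-- Left eigenvector `l⁴`. -/
def t4 (c₁ c₂ σ₀ σ₁ : ℝ) (Φ : Fin 4 → ℝ) : Fin 4 → ℝ :=
  (1 / Kc4 c₁ c₂ σ₀ σ₁ Φ) •
    ![((mu1 c₁ c₂ σ₀ σ₁ Φ) ^ 2 - bb4 c₂ σ₁ Φ) / (2 * σ₁), Φ 1,
      ((mu1 c₁ c₂ σ₀ σ₁ Φ) ^ 2 - bb4 c₂ σ₁ Φ) / (2 * σ₁ * mu1 c₁ c₂ σ₀ σ₁ Φ),
      Φ 1 / mu1 c₁ c₂ σ₀ σ₁ Φ]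

/-- The family `i ↦ r_i` (0-indexed). -/
def svK (c₁ c₂ σ₀ σ₁ : ℝ) (i : Fin 4) (Φ : Fin 4 → ℝ) : Fin 4 → ℝ :=
  ![s1 c₁ c₂ σ₀ σ₁ Φ, s2 c₁ c₂ σ₀ σ₁ Φ, s3 c₁ c₂ σ₀ σ₁ Φ, s4 c₁ c₂ σ₀ σ₁ Φ] i

/-- The family `i ↦ l^i` (0-indexed). -/
def tvK (c₁ c₂ σ₀ σ₁ : ℝ) (i : Fin 4) (Φ : Fin 4 → ℝ) : Fin 4 → ℝ :=
  ![t1 c₁ c₂ σ₀ σ₁ Φ, t2 c₁ c₂ σ₀ σ₁ Φ, t3 c₁ c₂ σ₀ σ₁ Φ, t4 c₁ c₂ σ₀ σ₁ Φ] i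

theorem eventually_coefficients_pos (c₁ c₂ σ₀ σ₁ : ℝ) (h₁ : c₁ ≠ 0) (h₂ : c₂ ≠ 0) :
    ∃ ε > (0 : ℝ), ∀ Φ : Fin 4 → ℝ, ‖Φ‖ < ε →
      0 < aa4 c₁ σ₀ Φ ∧ 0 < bb4 c₂ σ₁ Φ ∧
        (cc4 σ₁ Φ) ^ 2 < aa4 c₁ σ₀ Φ * bb4 c₂ σ₁ Φ := by
  have ha : Continuous (aa4 c₁ σ₀) := by unfold aa4; fun_prop
  have hb : Continuous (bb4 c₂ σ₁) := by unfold bb4; fun_prop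
  have hc : Continuous (cc4 σ₁) := by unfold cc4; fun_prop
  have ha0 : 0 < aa4 c₁ σ₀ 0 := by simpa [aa4] using sq_pos_of_ne_zero h₁
  have hb0 : 0 < bb4 c₂ σ₁ 0 := by simpa [bb4] using sq_pos_of_ne_zero h₂
  have hc0 : (cc4 σ₁ 0) ^ 2 < aa4 c₁ σ₀ 0 * bb4 c₂ σ₁ 0 := by
    have : cc4 σ₁ 0 = 0 := by simp [cc4]
    rw [this, zero_pow two_ne_zero]
    exact mul_pos ha0 hb0
  have hev := (continuousAt_const.eventually_lt ha.continuousAt ha0).and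
    ((continuousAt_const.eventually_lt hb.continuousAt hb0).and
      ((hc.pow 2).continuousAt.eventually_lt (ha.mul hb).continuousAt hc0))
  obtain ⟨ε, hε, h⟩ := Metric.eventually_nhds_iff.mp hev
  exact ⟨ε, hε, fun Φ hΦ => h (by simpa using hΦ)⟩

theorem sqrt_discriminant_lt {a b c : ℝ} (ha : 0 < a) (hb : 0 < b) (hc : c ^ 2 < a * b) :
    √((a - b) ^ 2 + 4 * c ^ 2) < a + b := by
  rw [Real.sqrt_lt' (by positivity)]
  linarith

theorem abs_sub_lt_sqrt_discriminant (a b : ℝ) {c : ℝ} (hc : c ≠ 0) :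
    |a - b| < √((a - b) ^ 2 + 4 * c ^ 2) := by
  apply Real.lt_sqrt_of_sq_lt
  rw [sq_abs]
  have := sq_pos_of_ne_zero hc
  linarith

theorem dotProduct_wave_vectors {k : Type*} [Field k] (p q x m n : k) :
    ![p, x, p / m, x / m] ⬝ᵥ ![q, x, n * q, n * x] = (p * q + x ^ 2) * (1 + n / m) := by
  simp [dotProduct, Fin.sum_univ_four]
  ring

/-- **2D biorthogonality** (Section 11). -/
theorem biorthogonality_2D (c₁ c₂ σ₀ σ₁ : ℝ)
    (hc : c₂ < c₁) (hc2 : 0 < c₂) (hσ0 : σ₀ ≠ 0) (hσ1 : σ₁ ≠ 0) :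
    ∃ δ > (0 : ℝ), ∀ Φ : Fin 4 → ℝ, ‖Φ‖ < 2 * δ → Φ 1 ≠ 0 →
      ((mu1 c₁ c₂ σ₀ σ₁ Φ) ^ 2 - bb4 c₂ σ₁ Φ) *
          ((mu2 c₁ c₂ σ₀ σ₁ Φ) ^ 2 - bb4 c₂ σ₁ Φ) + (cc4 σ₁ Φ) ^ 2 = 0 ∧
      Kc4 c₁ c₂ σ₀ σ₁ Φ ≠ 0 ∧ Nc4 c₁ c₂ σ₀ σ₁ Φ ≠ 0 ∧
      ∀ i j : Fin 4,
        tvK c₁ c₂ σ₀ σ₁ i Φ ⬝ᵥ svK c₁ c₂ σ₀ σ₁ j Φ = if i = j then 1 else 0 := by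
  obtain ⟨ε, hε, h⟩ :=
    eventually_coefficients_pos c₁ c₂ σ₀ σ₁ (hc2.trans hc).ne' hc2.ne'
  refine ⟨ε / 2, half_pos hε, fun Φ hΦ hφ => ?_⟩
  obtain ⟨ha, hb, hab⟩ := h Φ (by linarith)
  have hcc : cc4 σ₁ Φ ≠ 0 := mul_ne_zero (mul_ne_zero two_ne_zero hσ1) hφ
  have hlt : √(Del4 c₁ c₂ σ₀ σ₁ Φ) < _ := sqrt_discriminant_lt ha hb hab
  obtain ⟨hs₁, hs₂⟩ : -√(Del4 c₁ c₂ σ₀ σ₁ Φ) < _ ∧ _ < √(Del4 c₁ c₂ σ₀ σ₁ Φ) :=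
    abs_lt.mp (abs_sub_lt_sqrt_discriminant (aa4 c₁ σ₀ Φ) (bb4 c₂ σ₁ Φ) hcc)
  have hD : √(Del4 c₁ c₂ σ₀ σ₁ Φ) ^ 2 = Del4 c₁ c₂ σ₀ σ₁ Φ :=
    Real.sq_sqrt (by unfold Del4; positivity)
  have hs : (aa4 c₁ σ₀ Φ - bb4 c₂ σ₁ Φ) ^ 2 + 4 * (2 * σ₁ * Φ 1) ^ 2 =
      √(Del4 c₁ c₂ σ₀ σ₁ Φ) ^ 2 := hD.symm
  have hs0 : 0 < √(Del4 c₁ c₂ σ₀ σ₁ Φ) := by linarith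
  have hm₁ : 0 < mu1 c₁ c₂ σ₀ σ₁ Φ := Real.sqrt_pos.mpr (by linarith)
  have hm₂ : 0 < mu2 c₁ c₂ σ₀ σ₁ Φ := Real.sqrt_pos.mpr (by linarith)
  have hq₁ : mu1 c₁ c₂ σ₀ σ₁ Φ ^ 2 = _ := Real.sq_sqrt (Real.sqrt_pos.mp hm₁).le
  have hq₂ : mu2 c₁ c₂ σ₀ σ₁ Φ ^ 2 = _ := Real.sq_sqrt (Real.sqrt_pos.mp hm₂).le
  have hK : 2 * (((mu1 c₁ c₂ σ₀ σ₁ Φ ^ 2 - bb4 c₂ σ₁ Φ) / (2 * σ₁)) ^ 2 + Φ 1 ^ 2) =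
      Kc4 c₁ c₂ σ₀ σ₁ Φ := by
    rw [Kc4, ← hD, Real.sqrt_sq hs0.le, hq₁]
    field_simp
    linear_combination 4 * hs
  have hN : 2 * (((mu2 c₁ c₂ σ₀ σ₁ Φ ^ 2 - bb4 c₂ σ₁ Φ) / (2 * σ₁)) ^ 2 + Φ 1 ^ 2) =
      Nc4 c₁ c₂ σ₀ σ₁ Φ := by
    rw [Nc4, ← hD, Real.sqrt_sq hs0.le, hq₂]
    field_simp
    linear_combination 4 * hs
  have hprod : (mu1 c₁ c₂ σ₀ σ₁ Φ ^ 2 - bb4 c₂ σ₁ Φ) *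
      (mu2 c₁ c₂ σ₀ σ₁ Φ ^ 2 - bb4 c₂ σ₁ Φ) + cc4 σ₁ Φ ^ 2 = 0 := by
    rw [hq₁, hq₂, cc4]
    linear_combination hs / 4
  have horth : (mu1 c₁ c₂ σ₀ σ₁ Φ ^ 2 - bb4 c₂ σ₁ Φ) / (2 * σ₁) *
      ((mu2 c₁ c₂ σ₀ σ₁ Φ ^ 2 - bb4 c₂ σ₁ Φ) / (2 * σ₁)) + Φ 1 ^ 2 = 0 := by
    rw [cc4] at hprod
    field_simp
    linear_combination hprod
  have hK0 : Kc4 c₁ c₂ σ₀ σ₁ Φ ≠ 0 := by rw [← hK]; positivity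
  have hN0 : Nc4 c₁ c₂ σ₀ σ₁ Φ ≠ 0 := by rw [← hN]; positivity
  refine ⟨hprod, hK0, hN0, fun i j => ?_⟩
  set p := (mu1 c₁ c₂ σ₀ σ₁ Φ ^ 2 - bb4 c₂ σ₁ Φ) / (2 * σ₁) with hp
  set q := (mu2 c₁ c₂ σ₀ σ₁ Φ ^ 2 - bb4 c₂ σ₁ Φ) / (2 * σ₁) with hq
  have horth' : q * p + Φ 1 ^ 2 = 0 := by rw [mul_comm, horth]
  have hs1 : s1 c₁ c₂ σ₀ σ₁ Φ =
      ![p, Φ 1, -mu1 c₁ c₂ σ₀ σ₁ Φ * p, (-mu1 c₁ c₂ σ₀ σ₁ Φ) * Φ 1] := by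
    rw [s1, neg_div, mul_div_assoc, ← neg_mul]
  have ht1 : t1 c₁ c₂ σ₀ σ₁ Φ = (1 / Kc4 c₁ c₂ σ₀ σ₁ Φ) •
      ![p, Φ 1, p / (-mu1 c₁ c₂ σ₀ σ₁ Φ), Φ 1 / (-mu1 c₁ c₂ σ₀ σ₁ Φ)] := by
    rw [t1, hp, div_neg, div_neg, div_div]
  have hs2 : s2 c₁ c₂ σ₀ σ₁ Φ =
      ![q, Φ 1, -mu2 c₁ c₂ σ₀ σ₁ Φ * q, (-mu2 c₁ c₂ σ₀ σ₁ Φ) * Φ 1] := by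
    rw [s2, neg_div, mul_div_assoc, ← neg_mul]
  have ht2 : t2 c₁ c₂ σ₀ σ₁ Φ = (1 / Nc4 c₁ c₂ σ₀ σ₁ Φ) •
      ![q, Φ 1, q / (-mu2 c₁ c₂ σ₀ σ₁ Φ), Φ 1 / (-mu2 c₁ c₂ σ₀ σ₁ Φ)] := by
    rw [t2, hq, div_neg, div_neg, div_div]
  have hs3 : s3 c₁ c₂ σ₀ σ₁ Φ = ![q, Φ 1, mu2 c₁ c₂ σ₀ σ₁ Φ * q, mu2 c₁ c₂ σ₀ σ₁ Φ * Φ 1] := by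
    rw [s3, mul_div_assoc]
  have ht3 : t3 c₁ c₂ σ₀ σ₁ Φ = (1 / Nc4 c₁ c₂ σ₀ σ₁ Φ) •
      ![q, Φ 1, q / mu2 c₁ c₂ σ₀ σ₁ Φ, Φ 1 / mu2 c₁ c₂ σ₀ σ₁ Φ] := by
    rw [t3, hq, div_div]
  have hs4 : s4 c₁ c₂ σ₀ σ₁ Φ = ![p, Φ 1, mu1 c₁ c₂ σ₀ σ₁ Φ * p, mu1 c₁ c₂ σ₀ σ₁ Φ * Φ 1] := by
    rw [s4, mul_div_assoc]
  have ht4 : t4 c₁ c₂ σ₀ σ₁ Φ = (1 / Kc4 c₁ c₂ σ₀ σ₁ Φ) •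
      ![p, Φ 1, p / mu1 c₁ c₂ σ₀ σ₁ Φ, Φ 1 / mu1 c₁ c₂ σ₀ σ₁ Φ] := by
    rw [t4, hp, div_div]
  have hKp : (Kc4 c₁ c₂ σ₀ σ₁ Φ)⁻¹ * ((p * p + Φ 1 ^ 2) * (1 + 1)) = 1 := by
    rw [inv_mul_eq_one₀ hK0, ← hK]; ring
  have hNq : (Nc4 c₁ c₂ σ₀ σ₁ Φ)⁻¹ * ((q * q + Φ 1 ^ 2) * (1 + 1)) = 1 := by
    rw [inv_mul_eq_one₀ hN0, ← hN]; ring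
  fin_cases i <;> fin_cases j <;>
    simp only [tvK, svK, hs1, hs2, hs3, hs4, ht1, ht2, ht3, ht4, Fin.zero_eta, Fin.mk_one,
      Fin.reduceFinMk, cons_val, smul_dotProduct, dotProduct_wave_vectors, horth, horth'] <;>
    simp [hKp, hNq, hm₁.ne', hm₂.ne', neg_div, div_neg]
end
end

section
/- Initial data profile in H¹(ℝ³) (Appendix Lemma A.1): Fix α ∈ (0, 1/2). There exists a constant C > 0 depending only on α such that for every η ∈ (0,1), every θ > 0 and every admissible mollifier ζ as above, there exists a smooth compactly supported function ŵ : ℝ³ → ℝ with ŵ(x, Y², Y³) = w(x) for every (x, Y², Y³) in the ball B = {(x,Y²,Y³) ∈ ℝ³ : (x − 3η/2)² + (Y²)² + (Y³)² ≤ (η/2)²}, and ∫_{ℝ³} |∇ŵ|² ≤ C · θ² η · (1 + |ln(6η/5)|^α + |ln(9η/5)|^α)². -/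
noncomputable section

open Real MeasureTheory

/-- The Lindblad-type data profile
`w(x) = θ ∫ ζ(y) |ln(x−y)|^α χ_{[6η/5, 9η/5]}(x−y) dy`. -/
def wdata (η θ α : ℝ) (ζ : ℝ → ℝ) (x : ℝ) : ℝ :=
  θ * ∫ y : ℝ, ζ y * |Real.log (x - y)| ^ α *
      Set.indicator (Set.Icc (6 * η / 5) (9 * η / 5)) (fun _ => (1 : ℝ)) (x - y)

/-- `ζ` is an admissible mollifier at scale `η/10`. -/
def AdmissibleMollifier (η : ℝ) (ζ : ℝ → ℝ) : Prop :=
  ContDiff ℝ (⊤ : ℕ∞) ζ ∧ HasCompactSupport ζ ∧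
    Function.support ζ ⊆ Set.Icc (-(η / 10)) (η / 10) ∧
    (∀ x, 0 ≤ ζ x ∧ ζ x ≤ 20 / η) ∧ (∫ x : ℝ, ζ x) = 1

/-- On `[a, b]`, the sum of a nonnegative monotone and a nonnegative antitone function, cut off to
zero outside `[a, b]`, is a difference of two monotone functions with values in
`[0, v a + u b]`. -/
lemma exists_monotone_sub_eq_indicator {u v : ℝ → ℝ} {a b : ℝ} (hab : a ≤ b)
    (hu : MonotoneOn u (Set.Icc a b)) (hv : AntitoneOn v (Set.Icc a b))
    (hu0 : ∀ t ∈ Set.Icc a b, 0 ≤ u t) (hv0 : ∀ t ∈ Set.Icc a b, 0 ≤ v t) :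
    ∃ P Q : ℝ → ℝ, Monotone P ∧ Monotone Q ∧ (∀ t, 0 ≤ P t ∧ P t ≤ v a + u b) ∧
      (∀ t, 0 ≤ Q t ∧ Q t ≤ v a + u b) ∧
      ∀ t, Set.indicator (Set.Icc a b) (fun t => u t + v t) t = P t - Q t := by
  have ha : a ∈ Set.Icc a b := ⟨le_rfl, hab⟩
  have hb : b ∈ Set.Icc a b := ⟨hab, le_rfl⟩
  have hu_b : ∀ t, a ≤ t → t ≤ b → u t ≤ u b := fun t h₁ h₂ => hu ⟨h₁, h₂⟩ hb h₂
  have hv_a : ∀ t, a ≤ t → t ≤ b → v t ≤ v a := fun t h₁ h₂ => hv ha ⟨h₁, h₂⟩ h₁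
  have hu0' : ∀ t, a ≤ t → t ≤ b → 0 ≤ u t := fun t h₁ h₂ => hu0 t ⟨h₁, h₂⟩
  have hv0' : ∀ t, a ≤ t → t ≤ b → 0 ≤ v t := fun t h₁ h₂ => hv0 t ⟨h₁, h₂⟩
  have hua := hu0 a ha
  have hub := hu0 b hb
  have hva := hv0 a ha
  refine ⟨fun t => if t < a then 0 else if t ≤ b then v a + u t else v a + u b,
    fun t => if t < a then 0 else if t ≤ b then v a - v t else v a + u b, ?_, ?_, ?_, ?_, ?_⟩
  · intro s t hst
    have h₁ : a ≤ s → t ≤ b → u s ≤ u t := fun h h' =>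
      hu ⟨h, hst.trans h'⟩ ⟨h.trans hst, h'⟩ hst
    dsimp only
    split_ifs <;> grind
  · intro s t hst
    have h₁ : a ≤ s → t ≤ b → v t ≤ v s := fun h h' =>
      hv ⟨h, hst.trans h'⟩ ⟨h.trans hst, h'⟩ hst
    dsimp only
    split_ifs <;> grind
  · intro t
    dsimp only
    split_ifs <;> grind
  · intro t
    dsimp only
    split_ifs <;> grind
  · intro t
    simp only [Set.indicator_apply, Set.mem_Icc]
    split_ifs <;> grind

lemma integrable_mul_comp_sub_of_monotone {ζ P : ℝ → ℝ} (hζ : Continuous ζ)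
    (hζc : HasCompactSupport ζ) (hP : Monotone P) (x : ℝ) :
    Integrable fun y => ζ y * P (x - y) := by
  have h : LocallyIntegrable fun y => P (x - y) := by
    have h : Antitone fun y => P (x - y) := fun s t hst => hP (by linarith)
    exact h.locallyIntegrable
  simpa only [smul_eq_mul] using h.integrable_smul_left_of_hasCompactSupport hζ hζc

lemma abs_integral_mul_comp_sub_sub_le {ζ P : ℝ → ℝ} {K M r : ℝ} (hζ : Continuous ζ)
    (hζc : HasCompactSupport ζ) (hr : 0 ≤ r) (hsupp : Function.support ζ ⊆ Set.Icc (-r) r)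
    (hζK : ∀ y, 0 ≤ ζ y ∧ ζ y ≤ K) (hP : Monotone P) (hPM : ∀ t, 0 ≤ P t ∧ P t ≤ M) (x x' : ℝ) :
    |(∫ y, ζ y * P (x' - y)) - ∫ y, ζ y * P (x - y)| ≤ K * M * |x' - x| := by
  wlog hx : x ≤ x' generalizing x x'
  · rw [abs_sub_comm, abs_sub_comm x' x]
    exact this x' x (le_of_not_ge hx)
  have hK : 0 ≤ K := (hζK 0).1.trans (hζK 0).2
  have hi := integrable_mul_comp_sub_of_monotone hζ hζc hP
  have hloc : ∀ z, Integrable (fun y => P (z - y)) (volume.restrict (Set.Icc (-r) r)) := by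
    intro z
    have h : Antitone fun y => P (z - y) := fun s t hst => hP (by linarith)
    exact h.locallyIntegrable.integrableOn_isCompact isCompact_Icc
  have hPi : ∀ c d, IntervalIntegrable P volume c d := fun c d => hP.intervalIntegrable
  have hdiff : ∀ y, 0 ≤ P (x' - y) - P (x - y) := fun y =>
    sub_nonneg.2 (hP (by linarith))
  rw [← integral_sub (hi x') (hi x), abs_of_nonneg
    (integral_nonneg fun y => by
      have := mul_nonneg (hζK y).1 (hdiff y)
      simp only [Pi.zero_apply]; linarith), abs_of_nonneg (sub_nonneg.2 hx)]
  have hset : (∫ y, (ζ y * P (x' - y) - ζ y * P (x - y)))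
      = ∫ y in Set.Icc (-r) r, (ζ y * P (x' - y) - ζ y * P (x - y)) := by
    symm
    apply setIntegral_eq_integral_of_forall_compl_eq_zero
    intro y hy
    have : ζ y = 0 := by
      by_contra h
      exact hy (hsupp h)
    simp [this]
  have hshift : ∀ z, (∫ y in Set.Icc (-r) r, P (z - y)) = ∫ t in (z - r)..(z + r), P t := by
    intro z
    rw [integral_Icc_eq_integral_Ioc, ← intervalIntegral.integral_of_le (by linarith),
      intervalIntegral.integral_comp_sub_left (fun t => P t) z, sub_neg_eq_add]
  have hup : (∫ t in (x + r)..(x' + r), P t) ≤ M * (x' - x) := by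
    have := intervalIntegral.integral_mono_on (a := x + r) (b := x' + r) (by linarith)
      (hPi _ _) intervalIntegrable_const (fun t _ => (hPM t).2)
    simp only [intervalIntegral.integral_const, smul_eq_mul] at this
    linarith
  have hlow : 0 ≤ ∫ t in (x - r)..(x' - r), P t :=
    intervalIntegral.integral_nonneg (by linarith) fun t _ => (hPM t).1
  have e₁ := intervalIntegral.integral_add_adjacent_intervals (hPi (x - r) (x + r))
    (hPi (x + r) (x' + r))
  have e₂ := intervalIntegral.integral_add_adjacent_intervals (hPi (x - r) (x' - r))
    (hPi (x' - r) (x' + r))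
  calc (∫ y, (ζ y * P (x' - y) - ζ y * P (x - y)))
      ≤ ∫ y in Set.Icc (-r) r, K * (P (x' - y) - P (x - y)) := by
        rw [hset]
        refine integral_mono ((hi x').sub (hi x)).integrableOn
          (((hloc x').sub (hloc x)).const_mul K) fun y => ?_
        have := mul_le_mul_of_nonneg_right (hζK y).2 (hdiff y)
        dsimp only
        linarith
    _ = K * ((∫ t in (x' - r)..(x' + r), P t) - ∫ t in (x - r)..(x + r), P t) := by
        rw [integral_const_mul, integral_sub (hloc x') (hloc x), hshift, hshift]
    _ ≤ K * (M * (x' - x)) := by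
        gcongr
        linarith
    _ = K * M * (x' - x) := by ring

lemma abs_integral_mul_comp_sub_le {ζ f : ℝ → ℝ} {M : ℝ} (hζ : Integrable ζ)
    (hζ0 : ∀ y, 0 ≤ ζ y) (hζ1 : ∫ y, ζ y = 1) (hf : ∀ t, |f t| ≤ M) (x : ℝ) :
    |∫ y, ζ y * f (x - y)| ≤ M := by
  have := norm_integral_le_of_norm_le (f := fun y => ζ y * f (x - y)) (hζ.mul_const M)
    (Filter.Eventually.of_forall fun y => by
      rw [norm_mul, Real.norm_eq_abs, Real.norm_eq_abs, abs_of_nonneg (hζ0 y)]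
      exact mul_le_mul_of_nonneg_left (hf _) (hζ0 y))
  rwa [integral_mul_const, hζ1, one_mul] at this

lemma abs_log_rpow_eq_add {α : ℝ} (hα : 0 < α) (t : ℝ) :
    |log t| ^ α = max (log t) 0 ^ α + max (-log t) 0 ^ α := by
  rcases le_total 0 (log t) with h | h
  · rw [abs_of_nonneg h, max_eq_left h, max_eq_right (by linarith), zero_rpow hα.ne', add_zero]
  · rw [abs_of_nonpos h, max_eq_right h, max_eq_left (by linarith), zero_rpow hα.ne', zero_add]

/-- The profile `wdata` is smooth, bounded by `θ L`, and has derivative bounded by `40 θ L / η`,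
where `L = |log (6η/5)|^α + |log (9η/5)|^α`. -/
lemma wdata_contDiff_and_bounds {α η θ : ℝ} {ζ : ℝ → ℝ} (hα : 0 < α) (hη : 0 < η) (hθ : 0 < θ)
    (hζ : AdmissibleMollifier η ζ) :
    ContDiff ℝ (⊤ : ℕ∞) (wdata η θ α ζ) ∧
      (∀ x, |wdata η θ α ζ x| ≤ θ * (|log (6 * η / 5)| ^ α + |log (9 * η / 5)| ^ α)) ∧
      ∀ x x', |wdata η θ α ζ x' - wdata η θ α ζ x| ≤
        40 / η * (θ * (|log (6 * η / 5)| ^ α + |log (9 * η / 5)| ^ α)) * |x' - x| := by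
  obtain ⟨hsm, hcs, hsupp, hbd, hone⟩ := hζ
  have hpos : ∀ t ∈ Set.Icc (6 * η / 5) (9 * η / 5), 0 < t := fun t ht =>
    lt_of_lt_of_le (by positivity) ht.1
  obtain ⟨P, Q, hP, hQ, hPM, hQM, hPQ⟩ := exists_monotone_sub_eq_indicator
    (u := fun t => max (log t) 0 ^ α) (v := fun t => max (-log t) 0 ^ α)
    (a := 6 * η / 5) (b := 9 * η / 5) (by linarith)
    (fun s hs t ht hst => by
      have := log_le_log (hpos s hs) hst
      dsimp only
      gcongr)
    (fun s hs t ht hst => by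
      have := log_le_log (hpos s hs) hst
      dsimp only
      gcongr)
    (fun t _ => by positivity) (fun t _ => by positivity)
  set M := max (-log (6 * η / 5)) 0 ^ α + max (log (9 * η / 5)) 0 ^ α with hM
  have hML : M ≤ |log (6 * η / 5)| ^ α + |log (9 * η / 5)| ^ α := by
    rw [hM]
    gcongr
    · exact max_le (neg_le_abs _) (abs_nonneg _)
    · exact max_le (le_abs_self _) (abs_nonneg _)
  set L := |log (6 * η / 5)| ^ α + |log (9 * η / 5)| ^ α
  have hw : ∀ x, wdata η θ α ζ x = θ * ∫ y, ζ y * (P (x - y) - Q (x - y)) := by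
    intro x
    rw [wdata]
    congr 2 with y
    rw [← hPQ, mul_assoc]
    by_cases h : x - y ∈ Set.Icc (6 * η / 5) (9 * η / 5)
    · rw [Set.indicator_of_mem h, Set.indicator_of_mem h, mul_one, abs_log_rpow_eq_add hα]
    · rw [Set.indicator_of_notMem h, Set.indicator_of_notMem h, mul_zero]
  refine ⟨?_, fun x => ?_, fun x x' => ?_⟩
  · have hconv := hcs.contDiff_convolution_left (ContinuousLinearMap.mul ℝ ℝ) (μ := volume) hsm
      (hP.locallyIntegrable.sub hQ.locallyIntegrable)
    have : wdata η θ α ζ = fun x => θ *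
        convolution ζ (P - Q) (ContinuousLinearMap.mul ℝ ℝ) volume x := by
      funext x
      rw [hw]
      rfl
    rw [this]
    exact contDiff_const.mul hconv
  · rw [hw, abs_mul, abs_of_pos hθ]
    gcongr
    refine (abs_integral_mul_comp_sub_le (f := fun t => P t - Q t)
      (hsm.continuous.integrable_of_hasCompactSupport hcs)
      (fun y => (hbd y).1) hone (fun t => ?_) x).trans hML
    have h₁ := hPM t
    have h₂ := hQM t
    rw [abs_le]
    constructor <;> linarith
  · have hi := fun {R : ℝ → ℝ} (hR : Monotone R) z =>
      integrable_mul_comp_sub_of_monotone hsm.continuous hcs hR z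
    have hsplit : ∀ z, (∫ y, ζ y * (P (z - y) - Q (z - y)))
        = (∫ y, ζ y * P (z - y)) - ∫ y, ζ y * Q (z - y) := by
      intro z
      rw [← integral_sub (hi hP z) (hi hQ z)]
      simp only [mul_sub]
    have h₁ := abs_integral_mul_comp_sub_sub_le hsm.continuous hcs (by positivity) hsupp hbd hP
      hPM x x'
    have h₂ := abs_integral_mul_comp_sub_sub_le hsm.continuous hcs (by positivity) hsupp hbd hQ
      hQM x x'
    rw [hw, hw, hsplit, hsplit, ← mul_sub, abs_mul, abs_of_pos hθ]
    have h₃ : |(∫ y, ζ y * P (x' - y)) - (∫ y, ζ y * Q (x' - y)) -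
        ((∫ y, ζ y * P (x - y)) - ∫ y, ζ y * Q (x - y))| ≤ 2 * (20 / η * M * |x' - x|) := by
      rw [abs_le] at h₁ h₂ ⊢
      constructor <;> linarith [h₁.1, h₁.2, h₂.1, h₂.2]
    calc _ ≤ θ * (2 * (20 / η * M * |x' - x|)) := by gcongr
      _ ≤ θ * (2 * (20 / η * L * |x' - x|)) := by gcongr
      _ = _ := by ring

/-- A smooth bump function localised at scale `η`, times a function of the first coordinate
with bounds `A` and `B / η` on its size and Lipschitz constant, has Dirichlet energy `O(η)`. -/
lemma exists_cutoff_dirichlet_energy_le :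
    ∃ D : ℝ, 0 < D ∧ ∀ η : ℝ, 0 < η → ∀ A : ℝ, 0 ≤ A → ∀ w : ℝ → ℝ,
      ContDiff ℝ (⊤ : ℕ∞) w → (∀ x, |w x| ≤ A) →
      (∀ x x', |w x' - w x| ≤ 40 / η * A * |x' - x|) → ∀ c : EuclideanSpace ℝ (Fin 3),
      ∃ w3 : EuclideanSpace ℝ (Fin 3) → ℝ, ContDiff ℝ (⊤ : ℕ∞) w3 ∧ HasCompactSupport w3 ∧
        (∀ p, ‖p - c‖ ≤ η / 2 → w3 p = w (p 0)) ∧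
        (∫ p, ‖fderiv ℝ w3 p‖ ^ 2) ≤ D * A ^ 2 * η := by
  let ψ : ContDiffBump (0 : EuclideanSpace ℝ (Fin 3)) := ⟨1 / 2, 1, by norm_num, by norm_num⟩
  have hψ : ContDiff ℝ (⊤ : ℕ∞) ψ := ψ.contDiff
  obtain ⟨N, hN⟩ := (hψ.continuous_fderiv (by simp)).bounded_above_of_compact_support
    (ψ.hasCompactSupport.fderiv ℝ)
  have hN0 : 0 ≤ N := (norm_nonneg _).trans (hN 0)
  set V := volume.real (Metric.closedBall (0 : EuclideanSpace ℝ (Fin 3)) 1) with hV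
  refine ⟨(N + 40) ^ 2 * V + 1, by positivity, fun η hη A hA w hw hwA hwL c => ?_⟩
  let e : EuclideanSpace ℝ (Fin 3) →L[ℝ] ℝ := EuclideanSpace.proj 0
  have he : ‖e‖ ≤ 1 := e.opNorm_le_bound zero_le_one fun p => by
    rw [one_mul]
    exact PiLp.norm_apply_le p 0
  let φ : EuclideanSpace ℝ (Fin 3) → ℝ := fun p => ψ (η⁻¹ • (p - c))
  have hφ : ContDiff ℝ (⊤ : ℕ∞) φ := hψ.comp (by fun_prop)
  have hφ_zero : ∀ p, p ∉ Metric.closedBall c η → φ p = 0 := by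
    intro p hp
    apply ψ.zero_of_le_dist
    rw [dist_zero_right, norm_smul, norm_inv, Real.norm_of_nonneg hη.le, ← dist_eq_norm]
    rw [Metric.mem_closedBall, not_le] at hp
    change 1 ≤ η⁻¹ * dist p c
    rw [inv_mul_eq_div, one_le_div hη]
    exact hp.le
  have hφ_abs : ∀ p, |φ p| ≤ 1 := fun p => by
    rw [abs_of_nonneg ψ.nonneg]
    exact ψ.le_one
  have hφ' : ∀ p, ‖fderiv ℝ φ p‖ ≤ N / η := by
    intro p
    have h₁ : HasFDerivAt (fun p : EuclideanSpace ℝ (Fin 3) => η⁻¹ • (p - c))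
        (η⁻¹ • ContinuousLinearMap.id ℝ (EuclideanSpace ℝ (Fin 3))) p :=
      ((hasFDerivAt_id p).sub_const c).const_smul η⁻¹
    have h₂ := HasFDerivAt.comp (g := ψ) p
      (hψ.differentiable (by simp) (η⁻¹ • (p - c))).hasFDerivAt h₁
    change HasFDerivAt φ _ p at h₂
    rw [h₂.fderiv, ContinuousLinearMap.comp_smul, ContinuousLinearMap.comp_id, norm_smul, norm_inv,
      Real.norm_of_nonneg hη.le, inv_mul_eq_div]
    gcongr
    exact hN _
  have hwe : ContDiff ℝ (⊤ : ℕ∞) fun p : EuclideanSpace ℝ (Fin 3) => w (e p) :=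
    hw.comp e.contDiff
  have hwe' : ∀ p, ‖fderiv ℝ (fun p => w (e p)) p‖ ≤ 40 / η * A := by
    intro p
    refine norm_fderiv_le_of_lip' ℝ (by positivity) (Filter.Eventually.of_forall fun q => ?_)
    refine (hwL _ _).trans ?_
    gcongr
    rw [← map_sub, ← Real.norm_eq_abs]
    simpa using e.le_of_opNorm_le he (q - p)
  have hsm : ContDiff ℝ (⊤ : ℕ∞) fun p => φ p * w (e p) := hφ.mul hwe
  have hzero : ∀ p, p ∉ Metric.closedBall c η → φ p * w (e p) = 0 := fun p hp => by
    rw [hφ_zero p hp, zero_mul]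
  have hgrad : ∀ p, ‖fderiv ℝ (fun p => φ p * w (e p)) p‖ ≤ (N + 40) * A / η := by
    intro p
    rw [fderiv_fun_mul (hφ.differentiable (by simp) p) (hwe.differentiable (by simp) p)]
    refine (norm_add_le _ _).trans ?_
    rw [norm_smul, norm_smul, Real.norm_eq_abs, Real.norm_eq_abs]
    calc _ ≤ 1 * (40 / η * A) + A * (N / η) := by
          gcongr
          · exact hφ_abs p
          · exact hwe' p
          · exact hwA _
          · exact hφ' p
      _ = _ := by ring
  have hgrad_zero : ∀ p, p ∉ Metric.closedBall c η →
      ‖fderiv ℝ (fun p => φ p * w (e p)) p‖ ^ 2 = 0 := by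
    intro p hp
    have : (fun p => φ p * w (e p)) =ᶠ[nhds p] fun _ => 0 := by
      filter_upwards [Metric.isClosed_closedBall.isOpen_compl.mem_nhds hp] with q hq
      exact hzero q hq
    rw [this.fderiv_eq, fderiv_fun_const]
    simp
  have hvol : volume.real (Metric.closedBall c η) = η ^ 3 * V := by
    rw [hV, measureReal_def, Measure.addHaar_closedBall' _ _ hη.le, ENNReal.toReal_mul,
      ENNReal.toReal_ofReal (by positivity), finrank_euclideanSpace_fin, measureReal_def]
  refine ⟨fun p => φ p * w (e p), hsm,
    HasCompactSupport.intro (isCompact_closedBall c η) hzero, fun p hp => ?_, ?_⟩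
  · have : φ p = 1 := by
      apply ψ.one_of_mem_closedBall
      rw [mem_closedBall_zero_iff, norm_smul, norm_inv, Real.norm_of_nonneg hη.le]
      change η⁻¹ * ‖p - c‖ ≤ 1 / 2
      rw [inv_mul_eq_div, div_le_iff₀ hη]
      linarith
    simp [this, e]
  · rw [← setIntegral_eq_integral_of_forall_compl_eq_zero hgrad_zero]
    have hle := norm_setIntegral_le_of_norm_le_const (μ := volume) (s := Metric.closedBall c η)
      (f := fun p => ‖fderiv ℝ (fun p => φ p * w (e p)) p‖ ^ 2) (C := ((N + 40) * A / η) ^ 2)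
      measure_closedBall_lt_top fun p _ => by
        rw [norm_pow, norm_norm]
        gcongr
        exact hgrad p
    refine (le_abs_self _).trans (hle.trans ?_)
    rw [hvol]
    have : ((N + 40) * A / η) ^ 2 * (η ^ 3 * V) = (N + 40) ^ 2 * V * A ^ 2 * η := by
      field_simp
    rw [this]
    gcongr
    linarith

/-- **Initial data profile in `H¹(ℝ³)`** (Appendix Lemma A.1). -/
theorem data_profile_H1 (α : ℝ) (hα : 0 < α) (hα2 : α < 1 / 2) :
    ∃ C : ℝ, 0 < C ∧
      ∀ η ∈ Set.Ioo (0 : ℝ) 1, ∀ θ : ℝ, 0 < θ → ∀ ζ : ℝ → ℝ, AdmissibleMollifier η ζ →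
        ∃ w3 : EuclideanSpace ℝ (Fin 3) → ℝ,
          ContDiff ℝ (⊤ : ℕ∞) w3 ∧ HasCompactSupport w3 ∧
          (∀ p : EuclideanSpace ℝ (Fin 3),
            (p 0 - 3 * η / 2) ^ 2 + (p 1) ^ 2 + (p 2) ^ 2 ≤ (η / 2) ^ 2 →
            w3 p = wdata η θ α ζ (p 0)) ∧
          (∫ p : EuclideanSpace ℝ (Fin 3), ‖fderiv ℝ w3 p‖ ^ 2)
            ≤ C * θ ^ 2 * η *
              (1 + |Real.log (6 * η / 5)| ^ α + |Real.log (9 * η / 5)| ^ α) ^ 2 := by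
  obtain ⟨D, hD, hmain⟩ := exists_cutoff_dirichlet_energy_le
  refine ⟨D, hD, fun η hη θ hθ ζ hζ => ?_⟩
  have hη0 := hη.1
  obtain ⟨hsm, hbd, hlip⟩ := wdata_contDiff_and_bounds hα hη0 hθ hζ
  obtain ⟨w3, h₁, h₂, h₃, h₄⟩ := hmain η hη0 _ (by positivity) _ hsm hbd hlip
    (!₂[3 * η / 2, 0, 0])
  refine ⟨w3, h₁, h₂, fun p hp => h₃ p ?_, h₄.trans ?_⟩
  · rw [EuclideanSpace.norm_eq, Real.sqrt_le_left (by positivity)]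
    simpa [Fin.sum_univ_three] using hp
  · rw [mul_pow]
    calc _ = D * θ ^ 2 * η * (|log (6 * η / 5)| ^ α + |log (9 * η / 5)| ^ α) ^ 2 := by ring
      _ ≤ _ := by
        gcongr
        linarith
end
end

section
/- Gagliardo H^{1/2} bound for the data profile (core estimate of Appendix Lemma A.2): Fix α ∈ (0,1). There exists a constant C > 0 depending only on α such that for every η ∈ (0,1), every θ > 0 and every admissible mollifier ζ as above, η · ∬_{ℝ×ℝ} |w(x+y) − w(x)|² / |y|² dx dy ≤ C · θ² √η · (1 + |ln(6η/5)|^{2α} + |ln(9η/5)|^{2α} + |ln η|^{2α}). -/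
noncomputable section

open Real MeasureTheory

/-- A translation estimate in `L¹` for functions that are monotone up to one jump. -/
lemma integral_abs_translate_sub_le {g : ℝ → ℝ} (hg : Integrable g) {s c h M : ℝ} (hh : 0 ≤ h)
    (hb : ∀ u, |g (u + h) - g u| ≤
      s * (g (u + h) - g u) + Set.indicator (Set.Icc c (c + h)) (fun _ => 2 * M) u) :
    ∫ u, |g (u + h) - g u| ≤ 2 * M * h := by
  have hgh : Integrable (fun u => g (u + h)) := hg.comp_add_right h
  have hi : Integrable (Set.indicator (Set.Icc c (c + h)) (fun _ : ℝ => 2 * M)) :=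
    (integrable_indicator_iff measurableSet_Icc).2 continuous_const.integrableOn_Icc
  have hd : Integrable (fun u => s * (g (u + h) - g u)) := (hgh.sub hg).const_mul s
  calc ∫ u, |g (u + h) - g u|
      ≤ ∫ u, (s * (g (u + h) - g u) + Set.indicator (Set.Icc c (c + h)) (fun _ => 2 * M) u) :=
        integral_mono (hgh.sub hg).abs (hd.add hi) hb
    _ = 2 * M * h := by
        rw [integral_add hd hi, integral_const_mul, integral_sub hgh hg,
          integral_add_right_eq_self g h, integral_indicator measurableSet_Icc, setIntegral_const,
          Real.volume_real_Icc_of_le (by linarith), smul_eq_mul]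
        ring

/-- The sharp cut-off of `|log|^α` to a set. -/
def logPow (α : ℝ) (s : Set ℝ) : ℝ → ℝ := s.indicator fun u => |Real.log u| ^ α

lemma measurable_logPow (α : ℝ) {s : Set ℝ} (hs : MeasurableSet s) : Measurable (logPow α s) :=
  Measurable.indicator (by fun_prop) hs

lemma logPow_nonneg (α : ℝ) (s : Set ℝ) (u : ℝ) : 0 ≤ logPow α s u :=
  Set.indicator_nonneg (fun _ _ => by positivity) u

lemma abs_log_le_max {a b u : ℝ} (ha : 0 < a) (hu : u ∈ Set.Icc a b) :
    |Real.log u| ≤ max |Real.log a| |Real.log b| := by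
  have h1 := Real.log_le_log ha hu.1
  have h2 := Real.log_le_log (ha.trans_le hu.1) hu.2
  exact abs_le_max_abs_abs h1 h2

lemma logPow_le {α a b : ℝ} (hα : 0 < α) (ha : 0 < a) {s : Set ℝ} (hs : s ⊆ Set.Icc a b) (u : ℝ) :
    logPow α s u ≤ max |Real.log a| |Real.log b| ^ α := by
  unfold logPow
  by_cases hu : u ∈ s
  · rw [Set.indicator_of_mem hu]
    exact Real.rpow_le_rpow (abs_nonneg _) (abs_log_le_max ha (hs hu)) hα.le
  · rw [Set.indicator_of_notMem hu]
    positivity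

lemma integrable_logPow {α a b : ℝ} (hα : 0 < α) (ha : 0 < a) {s : Set ℝ}
    (hms : MeasurableSet s) (hs : s ⊆ Set.Icc a b) : Integrable (logPow α s) := by
  have hi : Integrable (Set.indicator (Set.Icc a b)
      (fun _ : ℝ => max |Real.log a| |Real.log b| ^ α)) :=
    (integrable_indicator_iff measurableSet_Icc).2 continuous_const.integrableOn_Icc
  refine hi.mono' (measurable_logPow α hms).aestronglyMeasurable (ae_of_all _ fun u => ?_)
  rw [Real.norm_of_nonneg (logPow_nonneg α s u)]
  by_cases hu : u ∈ s
  · rw [Set.indicator_of_mem (hs hu)]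
    exact logPow_le hα ha hs u
  · unfold logPow
    rw [Set.indicator_of_notMem hu]
    exact Set.indicator_nonneg (fun _ _ => by positivity) u

lemma integral_abs_translate_logPow_left_le {α a b h : ℝ} (hα : 0 < α) (ha : 0 < a) (hh : 0 ≤ h) :
    ∫ u, |logPow α (Set.Icc a b ∩ Set.Iic 1) (u + h) - logPow α (Set.Icc a b ∩ Set.Iic 1) u|
      ≤ 2 * max |Real.log a| |Real.log b| ^ α * h := by
  set s := Set.Icc a b ∩ Set.Iic 1
  have hs : s ⊆ Set.Icc a b := Set.inter_subset_left
  refine integral_abs_translate_sub_le (s := -1) (c := a - h)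
    (integrable_logPow hα ha (measurableSet_Icc.inter measurableSet_Iic) hs) hh fun u => ?_
  have h0 := logPow_nonneg α s u
  have h1 := logPow_nonneg α s (u + h)
  have h2 := logPow_le hα ha hs (u + h)
  by_cases hu : u ∈ Set.Icc (a - h) (a - h + h)
  · rw [Set.indicator_of_mem hu]
    cases abs_cases (logPow α s (u + h) - logPow α s u) <;> linarith
  · rw [Set.indicator_of_notMem hu]
    have key : logPow α s (u + h) ≤ logPow α s u := by
      by_cases hus : u + h ∈ s
      · have hu' : u ∈ s := by
          simp only [s, Set.mem_inter_iff, Set.mem_Icc, Set.mem_Iic] at hus hu ⊢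
          have : a ≤ u := by
            by_contra hc
            exact hu ⟨by linarith, by linarith⟩
          exact ⟨⟨this, by linarith⟩, by linarith⟩
        have hpos : 0 < u := ha.trans_le (hs hu').1
        unfold logPow
        rw [Set.indicator_of_mem hus, Set.indicator_of_mem hu']
        refine Real.rpow_le_rpow (abs_nonneg _) ?_ hα.le
        rw [abs_of_nonpos (Real.log_nonpos (by linarith) hus.2),
          abs_of_nonpos (Real.log_nonpos hpos.le hu'.2)]
        linarith [Real.log_le_log hpos (show u ≤ u + h by linarith)]
      · have : logPow α s (u + h) = 0 := Set.indicator_of_notMem hus _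
        rwa [this]
    rw [abs_of_nonpos (by linarith)]
    linarith

lemma integral_abs_translate_logPow_right_le {α a b h : ℝ} (hα : 0 < α) (ha : 0 < a)
    (hh : 0 ≤ h) :
    ∫ u, |logPow α (Set.Icc a b ∩ Set.Ioi 1) (u + h) - logPow α (Set.Icc a b ∩ Set.Ioi 1) u|
      ≤ 2 * max |Real.log a| |Real.log b| ^ α * h := by
  set s := Set.Icc a b ∩ Set.Ioi 1
  have hs : s ⊆ Set.Icc a b := Set.inter_subset_left
  refine integral_abs_translate_sub_le (s := 1) (c := b - h)
    (integrable_logPow hα ha (measurableSet_Icc.inter measurableSet_Ioi) hs) hh fun u => ?_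
  have h0 := logPow_nonneg α s u
  have h1 := logPow_nonneg α s (u + h)
  have h2 := logPow_le hα ha hs u
  by_cases hu : u ∈ Set.Icc (b - h) (b - h + h)
  · rw [Set.indicator_of_mem hu]
    cases abs_cases (logPow α s (u + h) - logPow α s u) <;> linarith
  · rw [Set.indicator_of_notMem hu]
    have key : logPow α s u ≤ logPow α s (u + h) := by
      by_cases hus : u ∈ s
      · have hu' : u + h ∈ s := by
          simp only [s, Set.mem_inter_iff, Set.mem_Icc, Set.mem_Ioi] at hus hu ⊢
          have : u + h ≤ b := by
            by_contra hc
            exact hu ⟨by linarith, by linarith⟩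
          exact ⟨⟨by linarith, this⟩, by linarith⟩
        have hpos : 0 < u := ha.trans_le (hs hus).1
        unfold logPow
        rw [Set.indicator_of_mem hus, Set.indicator_of_mem hu']
        refine Real.rpow_le_rpow (abs_nonneg _) ?_ hα.le
        rw [abs_of_nonneg (Real.log_nonneg (le_of_lt hus.2)),
          abs_of_nonneg (Real.log_nonneg (le_of_lt hu'.2))]
        exact Real.log_le_log hpos (by linarith)
      · have : logPow α s u = 0 := Set.indicator_of_notMem hus _
        rwa [this]
    rw [abs_of_nonneg (by linarith)]
    linarith

lemma integral_abs_translate_logPow_le {α a b h : ℝ} (hα : 0 < α) (ha : 0 < a) (hh : 0 ≤ h) :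
    ∫ u, |logPow α (Set.Icc a b) (u + h) - logPow α (Set.Icc a b) u|
      ≤ 4 * max |Real.log a| |Real.log b| ^ α * h := by
  have h1 := integral_abs_translate_logPow_left_le (b := b) hα ha hh
  have h2 := integral_abs_translate_logPow_right_le (b := b) hα ha hh
  have hsum : ∀ u, logPow α (Set.Icc a b) u =
      logPow α (Set.Icc a b ∩ Set.Iic 1) u + logPow α (Set.Icc a b ∩ Set.Ioi 1) u := by
    intro u
    by_cases hu : u ∈ Set.Icc a b <;> rcases le_or_gt u 1 with hu1 | hu1 <;>
      simp [logPow, Set.indicator, hu, hu1, not_lt.2, not_le.2]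
  have i1 := integrable_logPow (s := Set.Icc a b ∩ Set.Iic 1) hα ha
    (measurableSet_Icc.inter measurableSet_Iic) Set.inter_subset_left
  have i2 := integrable_logPow (s := Set.Icc a b ∩ Set.Ioi 1) hα ha
    (measurableSet_Icc.inter measurableSet_Ioi) Set.inter_subset_left
  have i := integrable_logPow (s := Set.Icc a b) hα ha measurableSet_Icc subset_rfl
  have j1 := ((i1.comp_add_right h).sub i1).abs
  have j2 := ((i2.comp_add_right h).sub i2).abs
  calc _ ≤ ∫ u, (|logPow α (Set.Icc a b ∩ Set.Iic 1) (u + h)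
            - logPow α (Set.Icc a b ∩ Set.Iic 1) u|
          + |logPow α (Set.Icc a b ∩ Set.Ioi 1) (u + h)
            - logPow α (Set.Icc a b ∩ Set.Ioi 1) u|) := by
        refine integral_mono ((i.comp_add_right h).sub i).abs (j1.add j2) fun u => ?_
        simp only [hsum]
        rw [add_sub_add_comm]
        exact abs_add_le _ _
    _ = _ := integral_add j1 j2
    _ ≤ _ := by linarith

lemma wdata_eq (η θ α : ℝ) (ζ : ℝ → ℝ) (x : ℝ) :
    wdata η θ α ζ x
      = θ * ∫ y, ζ y * logPow α (Set.Icc (6 * η / 5) (9 * η / 5)) (x - y) := by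
  unfold wdata logPow
  congr 2
  ext y
  by_cases hy : x - y ∈ Set.Icc (6 * η / 5) (9 * η / 5)
  · simp only [Set.indicator_of_mem hy, mul_one]
  · simp only [Set.indicator_of_notMem hy, mul_zero]

/-- The bound for `|log|^α` on the support of the sharp profile. -/
def logBound (η α : ℝ) : ℝ := max |Real.log (6 * η / 5)| |Real.log (9 * η / 5)| ^ α

section Profile

variable {η θ α : ℝ} {ζ : ℝ → ℝ}

lemma AdmissibleMollifier.integrable_mul (hζ : AdmissibleMollifier η ζ) (hη : 0 < η) (hα : 0 < α)
    (x : ℝ) :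
    Integrable fun y => ζ y * logPow α (Set.Icc (6 * η / 5) (9 * η / 5)) (x - y) := by
  have hi : Integrable ζ := hζ.1.continuous.integrable_of_hasCompactSupport hζ.2.1
  refine hi.mul_bdd (c := logBound η α) ?_ (ae_of_all _ fun y => ?_)
  · exact ((measurable_logPow α measurableSet_Icc).comp
      (measurable_const.sub measurable_id)).aestronglyMeasurable
  · rw [Real.norm_of_nonneg (logPow_nonneg _ _ _)]
    exact logPow_le hα (by positivity) subset_rfl _

lemma wdata_nonneg (hζ : AdmissibleMollifier η ζ) (hθ : 0 < θ) (x : ℝ) :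
    0 ≤ wdata η θ α ζ x := by
  rw [wdata_eq]
  exact mul_nonneg hθ.le
    (integral_nonneg fun y => mul_nonneg (hζ.2.2.2.1 y).1 (logPow_nonneg _ _ _))

lemma wdata_le (hζ : AdmissibleMollifier η ζ) (hη : 0 < η) (hθ : 0 < θ) (hα : 0 < α) (x : ℝ) :
    wdata η θ α ζ x ≤ θ * logBound η α := by
  have hi : Integrable ζ := hζ.1.continuous.integrable_of_hasCompactSupport hζ.2.1
  rw [wdata_eq]
  refine mul_le_mul_of_nonneg_left ?_ hθ.le
  calc _ ≤ ∫ y, ζ y * logBound η α :=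
        integral_mono (hζ.integrable_mul hη hα x) (hi.mul_const _) fun y =>
          mul_le_mul_of_nonneg_left (logPow_le hα (by positivity) subset_rfl _)
            (hζ.2.2.2.1 y).1
    _ = logBound η α := by rw [integral_mul_const, hζ.2.2.2.2, one_mul]

lemma wdata_eq_zero (hζ : AdmissibleMollifier η ζ) {x : ℝ} (hη : 0 < η)
    (hx : x ∉ Set.Icc η (2 * η)) : wdata η θ α ζ x = 0 := by
  rw [wdata_eq, integral_eq_zero_of_ae, mul_zero]
  refine ae_of_all _ fun y => ?_
  by_cases hy : ζ y = 0
  · simp [hy]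
  · have hy' := hζ.2.2.1 hy
    have : x - y ∉ Set.Icc (6 * η / 5) (9 * η / 5) := fun h =>
      hx ⟨by linarith [h.1, hy'.1], by linarith [h.2, hy'.2]⟩
    simp [logPow, Set.indicator_of_notMem this]

lemma abs_wdata_sub_le_of_nonneg (hζ : AdmissibleMollifier η ζ) (hη : 0 < η) (hθ : 0 < θ)
    (hα : 0 < α) (x : ℝ) {h : ℝ} (hh : 0 ≤ h) :
    |wdata η θ α ζ (x + h) - wdata η θ α ζ x| ≤ 80 * (θ * logBound η α) * h / η := by
  set f := logPow α (Set.Icc (6 * η / 5) (9 * η / 5)) with hf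
  have hfi : Integrable f :=
    integrable_logPow hα (show 0 < 6 * η / 5 by positivity) measurableSet_Icc subset_rfl
  have hdi : Integrable fun u => |f (u + h) - f u| := ((hfi.comp_add_right h).sub hfi).abs
  have hmain : ∫ u, |f (u + h) - f u| ≤ 4 * logBound η α * h :=
    integral_abs_translate_logPow_le hα (by positivity) hh
  rw [wdata_eq, wdata_eq, ← mul_sub, ← integral_sub (hζ.integrable_mul hη hα _)
    (hζ.integrable_mul hη hα _), abs_mul, abs_of_pos hθ]
  have hb : |∫ y, (ζ y * f (x + h - y) - ζ y * f (x - y))|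
      ≤ ∫ y, 20 / η * |f (x - y + h) - f (x - y)| := by
    rw [← Real.norm_eq_abs]
    refine norm_integral_le_of_norm_le ((hdi.comp_sub_left x).const_mul _)
      (ae_of_all _ fun y => ?_)
    rw [← mul_sub, norm_mul, Real.norm_of_nonneg (hζ.2.2.2.1 y).1, Real.norm_eq_abs,
      show x + h - y = x - y + h by ring]
    exact mul_le_mul_of_nonneg_right (hζ.2.2.2.1 y).2 (abs_nonneg _)
  rw [integral_const_mul, integral_sub_left_eq_self (fun u => |f (u + h) - f u|) volume x] at hb
  calc _ ≤ θ * (20 / η * (4 * logBound η α * h)) := by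
        refine mul_le_mul_of_nonneg_left (hb.trans ?_) hθ.le
        exact mul_le_mul_of_nonneg_left hmain (by positivity)
    _ = _ := by ring

lemma abs_wdata_sub_le (hζ : AdmissibleMollifier η ζ) (hη : 0 < η) (hθ : 0 < θ)
    (hα : 0 < α) (x y : ℝ) :
    |wdata η θ α ζ (x + y) - wdata η θ α ζ x| ≤ 80 * (θ * logBound η α) * |y| / η := by
  rcases le_total 0 y with hy | hy
  · rw [abs_of_nonneg hy]
    exact abs_wdata_sub_le_of_nonneg hζ hη hθ hα x hy
  · have := abs_wdata_sub_le_of_nonneg hζ hη hθ hα (x + y) (h := -y) (by linarith)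
    rwa [add_neg_cancel_right, abs_sub_comm, ← abs_of_nonpos hy] at this

end Profile

lemma integrable_and_integral_inv_sq_add_sq {η : ℝ} (hη : 0 < η) :
    Integrable (fun x : ℝ => (η ^ 2 + x ^ 2)⁻¹) ∧ ∫ x : ℝ, (η ^ 2 + x ^ 2)⁻¹ = π / η := by
  have he : (fun x : ℝ => (η ^ 2 + x ^ 2)⁻¹)
      = fun x => (η ^ 2)⁻¹ * (1 + (x / η) ^ 2)⁻¹ := by
    ext x
    rw [← mul_inv]
    congr 1
    field_simp
  rw [he]
  refine ⟨(integrable_inv_one_add_sq.comp_div hη.ne').const_mul _, ?_⟩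
  rw [integral_const_mul, Measure.integral_comp_div (fun x : ℝ => (1 + x ^ 2)⁻¹) η,
    integral_univ_inv_one_add_sq, abs_of_pos hη, smul_eq_mul]
  field_simp

/-- The squared `Ḣ^{1/2}` seminorm of a bounded Lipschitz function supported in `[η, 2η]`, with
Lipschitz constant at scale `1 / η`, is controlled by the square of its supremum. -/
lemma gagliardo_le_of_lipschitz {w : ℝ → ℝ} {η W : ℝ} (hη : 0 < η) (h0 : ∀ x, 0 ≤ w x)
    (hW : ∀ x, w x ≤ W) (hsupp : ∀ x, x ∉ Set.Icc η (2 * η) → w x = 0)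
    (hlip : ∀ x y, |w (x + y) - w x| ≤ 80 * W * |y| / η) :
    ∫ x : ℝ, ∫ y : ℝ, (w (x + y) - w x) ^ 2 / y ^ 2 ≤ 64010 * π ^ 2 * W ^ 2 := by
  obtain ⟨hJi, hJ⟩ := integrable_and_integral_inv_sq_add_sq hη
  have hW0 : 0 ≤ W := (h0 0).trans (hW 0)
  have hle : ∀ x y, (w (x + y) - w x) ^ 2 ≤ W ^ 2 := fun x y =>
    sq_le_sq' (by linarith [h0 (x + y), hW x]) (by linarith [h0 x, hW (x + y)])
  have hnear : ∀ x, ∫ y : ℝ, (w (x + y) - w x) ^ 2 / y ^ 2 ≤ 6401 * W ^ 2 * (π / η) := by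
    intro x
    rw [← hJ, ← integral_const_mul]
    refine integral_mono_of_nonneg (ae_of_all _ fun y => by positivity) (hJi.const_mul _)
      (ae_of_all _ fun y => ?_)
    simp only
    rcases eq_or_ne y 0 with rfl | hy
    · rw [add_zero, sub_self, zero_pow two_ne_zero, zero_div]
      positivity
    · have hl : (w (x + y) - w x) ^ 2 * η ^ 2 ≤ 6400 * W ^ 2 * y ^ 2 := by
        have h1 := hlip x y
        rw [le_div_iff₀ hη] at h1
        have h2 := pow_le_pow_left₀ (by positivity) h1 2
        rw [mul_pow, mul_pow, sq_abs, sq_abs] at h2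
        linarith
      rw [← div_eq_mul_inv, div_le_div_iff₀ (by positivity) (by positivity)]
      nlinarith [mul_le_mul_of_nonneg_right (hle x y) (sq_nonneg y)]
  have hfar : ∀ x, 3 * η < |x| →
      ∫ y : ℝ, (w (x + y) - w x) ^ 2 / y ^ 2 ≤ 9 * W ^ 2 / x ^ 2 * η := by
    intro x hx
    have hx0 : x ≠ 0 := by
      rintro rfl
      rw [abs_zero] at hx
      linarith
    have hwx : w x = 0 := hsupp x fun h => by
      rw [abs_of_nonneg (hη.le.trans h.1)] at hx
      linarith [h.2]
    have hi : Integrable (Set.indicator (Set.Icc (η - x) (2 * η - x))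
        (fun _ : ℝ => 9 * W ^ 2 / x ^ 2)) :=
      (integrable_indicator_iff measurableSet_Icc).2 continuous_const.integrableOn_Icc
    calc _ ≤ ∫ y, Set.indicator (Set.Icc (η - x) (2 * η - x))
            (fun _ : ℝ => 9 * W ^ 2 / x ^ 2) y := by
          refine integral_mono_of_nonneg (ae_of_all _ fun y => by positivity) hi
            (ae_of_all _ fun y => ?_)
          simp only
          by_cases hy : y ∈ Set.Icc (η - x) (2 * η - x)
          · rw [Set.indicator_of_mem hy]
            have hyx : |x| ≤ 3 * |y| := by
              obtain ⟨hy1, hy2⟩ := hy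
              rcases abs_cases x with ⟨h1, _⟩ | ⟨h1, _⟩ <;>
                rcases abs_cases y with ⟨h2, _⟩ | ⟨h2, _⟩ <;> linarith
            have hyx2 : x ^ 2 ≤ 9 * y ^ 2 := by
              have := pow_le_pow_left₀ (abs_nonneg x) hyx 2
              rw [mul_pow, sq_abs, sq_abs] at this
              linarith
            have hx2 : 0 < x ^ 2 := by positivity
            rw [div_le_div_iff₀ (by linarith) hx2]
            nlinarith [mul_le_mul_of_nonneg_right (hle x y) hx2.le,
              mul_le_mul_of_nonneg_left hyx2 (sq_nonneg W)]
          · have : w (x + y) = 0 := hsupp _ fun h =>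
              hy ⟨by linarith [h.1], by linarith [h.2]⟩
            rw [Set.indicator_of_notMem hy, this, hwx]
            simp
      _ = 9 * W ^ 2 / x ^ 2 * η := by
          rw [integral_indicator measurableSet_Icc, setIntegral_const, smul_eq_mul, mul_comm,
            Real.volume_real_Icc_of_le (by linarith)]
          ring
  have hpi : 1 ≤ π := by linarith [Real.pi_gt_three]
  calc _ ≤ ∫ x : ℝ, 64010 * W ^ 2 * π * η * (η ^ 2 + x ^ 2)⁻¹ := by
        refine integral_mono_of_nonneg
          (ae_of_all _ fun x => integral_nonneg fun y => by positivity) (hJi.const_mul _)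
          (ae_of_all _ fun x => ?_)
        simp only
        rcases le_or_gt |x| (3 * η) with hx | hx
        · refine (hnear x).trans ?_
          have hx2 : x ^ 2 ≤ 9 * η ^ 2 := by
            have := pow_le_pow_left₀ (abs_nonneg x) hx 2
            rw [mul_pow, sq_abs] at this
            linarith
          rw [← div_eq_mul_inv, ← mul_div_assoc, div_le_div_iff₀ hη (by positivity)]
          nlinarith [mul_le_mul_of_nonneg_left hx2 (show 0 ≤ W ^ 2 * π by positivity)]
        · refine (hfar x hx).trans ?_
          have hx2 : 9 * η ^ 2 ≤ x ^ 2 := by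
            have := pow_le_pow_left₀ (by positivity) hx.le 2
            rw [mul_pow, sq_abs] at this
            linarith
          have hxp : 0 < x ^ 2 := lt_of_lt_of_le (by positivity) hx2
          rw [← div_eq_mul_inv, div_mul_eq_mul_div, div_le_div_iff₀ hxp (by positivity)]
          have h1 : 9 * W ^ 2 * η * (η ^ 2 + x ^ 2) ≤ 9 * W ^ 2 * η * (2 * x ^ 2) :=
            mul_le_mul_of_nonneg_left (by nlinarith) (by positivity)
          have h2 : W ^ 2 * η * x ^ 2 * 1 ≤ W ^ 2 * η * x ^ 2 * π :=
            mul_le_mul_of_nonneg_left hpi (by positivity)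
          have h3 : 0 ≤ W ^ 2 * η * x ^ 2 := by positivity
          linarith
    _ = 64010 * π ^ 2 * W ^ 2 := by
        rw [integral_const_mul, hJ]
        field_simp

lemma logBound_sq_le (η α : ℝ) :
    logBound η α ^ 2 ≤ |Real.log (6 * η / 5)| ^ (2 * α) + |Real.log (9 * η / 5)| ^ (2 * α) := by
  have h1 : 0 ≤ |Real.log (6 * η / 5)| ^ (2 * α) := by positivity
  have h2 : 0 ≤ |Real.log (9 * η / 5)| ^ (2 * α) := by positivity
  have h : logBound η α ^ 2
      = max |Real.log (6 * η / 5)| |Real.log (9 * η / 5)| ^ (2 * α) := by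
    rw [logBound, ← Real.rpow_natCast, ← Real.rpow_mul (by positivity), mul_comm α]
    norm_num
  rw [h]
  rcases max_choice |Real.log (6 * η / 5)| |Real.log (9 * η / 5)| with h | h <;> rw [h] <;> linarith

/-- **Gagliardo `H^{1/2}` bound for the data profile**
(core estimate of Appendix Lemma A.2). -/
theorem data_profile_gagliardo (α : ℝ) (hα : 0 < α) (hα2 : α < 1) :
    ∃ C : ℝ, 0 < C ∧
      ∀ η ∈ Set.Ioo (0 : ℝ) 1, ∀ θ : ℝ, 0 < θ → ∀ ζ : ℝ → ℝ, AdmissibleMollifier η ζ →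
        η * (∫ x : ℝ, ∫ y : ℝ, (wdata η θ α ζ (x + y) - wdata η θ α ζ x) ^ 2 / y ^ 2)
          ≤ C * θ ^ 2 * Real.sqrt η *
            (1 + |Real.log (6 * η / 5)| ^ (2 * α) + |Real.log (9 * η / 5)| ^ (2 * α)
              + |Real.log η| ^ (2 * α)) := by
  refine ⟨64010 * π ^ 2, by positivity, fun η hη θ hθ ζ hζ => ?_⟩
  obtain ⟨hη0, hη1⟩ := hη
  have hmain := gagliardo_le_of_lipschitz hη0 (wdata_nonneg (α := α) hζ hθ)
    (wdata_le hζ hη0 hθ hα) (fun x hx => wdata_eq_zero hζ hη0 hx)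
    (abs_wdata_sub_le hζ hη0 hθ hα)
  have hsqrt : η ≤ Real.sqrt η := Real.le_sqrt_of_sq_le (by nlinarith)
  have hS : logBound η α ^ 2 ≤ 1 + |Real.log (6 * η / 5)| ^ (2 * α)
      + |Real.log (9 * η / 5)| ^ (2 * α) + |Real.log η| ^ (2 * α) := by
    have : 0 ≤ |Real.log η| ^ (2 * α) := by positivity
    linarith [logBound_sq_le η α]
  calc _ ≤ η * (64010 * π ^ 2 * (θ * logBound η α) ^ 2) :=
        mul_le_mul_of_nonneg_left hmain hη0.le
    _ = 64010 * π ^ 2 * θ ^ 2 * η * logBound η α ^ 2 := by ring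
    _ ≤ _ := by gcongr
end
end
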